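/- Let A and M be vector spaces over a field K, let μ : A × A → A be a bilinear map, and let l, r : A → End(M) be linear maps. Then the bilinear product on A ⊕ M defined by (a,m)·(b,n) = (μ(a,b), l(a)n + r(b)m) satisfies the anti-flexible identity if and only if μ makes A an anti-flexible algebra and l, r satisfy the bimodule equations l(μ(a,b)) − l(a)∘l(b) = r(a)∘r(b) − r(μ(b,a)) and l(a)∘r(b) − r(b)∘l(a) = l(b)∘r(a) − r(a)∘l(b) for all a, b ∈ A. -/

import Mathlib

/-- The anti-flexible identity for a (bilinear) product. -/
def AntiFlexible {A : Type*} [AddCommGroup A] (mul : A → A → A) : Prop :=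
  ∀ a b c : A, mul (mul a b) c - mul a (mul b c) = mul (mul c b) a - mul c (mul b a)

/-- the semidirect product `(a,m)·(b,n) = (μ(a,b), l(a)n + r(b)m)` on
`A ⊕ M` is anti-flexible iff `μ` is anti-flexible and `(l, r)` satisfy the bimodule
equations. -/
theorem semidirect_antiflexible_iff {K A M : Type*} [Field K]
    [AddCommGroup A] [Module K A] [AddCommGroup M] [Module K M]
    (mul : A →ₗ[K] A →ₗ[K] A) (l r : A →ₗ[K] Module.End K M) :
    AntiFlexible (fun p q : A × M => ((mul p.1 q.1, l p.1 q.2 + r q.1 p.2) : A × M)) ↔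
      (AntiFlexible fun a b => mul a b) ∧
      (∀ a b : A, l (mul a b) - l a * l b = r a * r b - r (mul b a)) ∧
      (∀ a b : A, l a * r b - r b * l a = l b * r a - r a * l b) := by
  constructor
  · intro h
    refine ⟨fun a b c => ?_, fun a b => ?_, fun a b => ?_⟩
    · simpa using congrArg Prod.fst (h (a, 0) (b, 0) (c, 0))
    · ext m
      simpa using congrArg Prod.snd (h (a, 0) (b, 0) (0, m))
    · ext m
      have hm := congrArg Prod.snd (h (a, 0) (0, m) (b, 0))
      simp only [Prod.snd_sub, map_zero, LinearMap.zero_apply, add_zero, zero_add] at hm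
      simpa using congrArg Neg.neg hm
  · rintro ⟨hA, h₁, h₂⟩ ⟨a, m⟩ ⟨b, n⟩ ⟨c, o⟩
    have ho := LinearMap.congr_fun (h₁ a b) o
    have hm := LinearMap.congr_fun (h₁ c b) m
    have hn := LinearMap.congr_fun (h₂ a c) n
    simp only [LinearMap.sub_apply, Module.End.mul_apply] at ho hm hn
    ext
    · exact hA a b c
    · simp only [Prod.snd_sub, map_add]
      linear_combination (norm := abel) ho - hm - hn
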